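/- arXiv:2206.00173 — 2 statements merged into one kernel-verified Lean document; each statement's English description precedes it below -/
import Mathlib

section
/- Let A be a multipartition matrix with k blocks and m columns satisfying the GRIP, and let d be a normalized data vector with positive entries. Then for every 1 ≤ ℓ ≤ k, the ℓ-th IPS iterate q^ℓ (starting from the uniform distribution q^0) equals the maximum likelihood estimate of d in the partition model M(A^{1,…,ℓ}) of the submatrix consisting of the first ℓ blocks. -/
open Finset

namespace PM

variable {k : ℕ} {J : Type*} {I : Type*} [Fintype J] [DecidableEq J] [DecidableEq I]

/- A partition matrix (a 0/1 matrix in which every column sums to 1), with columns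
indexed by `J` and rows indexed by `I`, is encoded by the map sending each column to the
unique row having a 1 in that column.  A multipartition matrix with `k` blocks is a
family `S : Fin k → J → I` of such maps (block `b` is the partition matrix whose row
through column `j` is `S b j`). -/

/-- Columns `j` and `j'` agree in the first `ℓ` blocks (blocks of index `< ℓ`). -/
def colEquiv (S : Fin k → J → I) (ℓ : ℕ) (j j' : J) : Prop :=
  ∀ b : Fin k, (b : ℕ) < ℓ → S b j = S b j'

instance {S : Fin k → J → I} {ℓ : ℕ} {j j' : J} : Decidable (colEquiv S ℓ j j') :=
  inferInstanceAs (Decidable (∀ b : Fin k, (b : ℕ) < ℓ → S b j = S b j'))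

/-- The column weight `c^ℓ_j` of column `j` in the stacked matrix of the first `ℓ` blocks. -/
def colWeight (S : Fin k → J → I) (ℓ : ℕ) (j : J) : ℕ :=
  (univ.filter fun j' => colEquiv S ℓ j j').card

/-- Well-connectedness: for every block `b` and all columns `j`, `j'` in the support of one
row of block `b`, `c^{b+1}_j / c^{b}_j = c^{b+1}_{j'} / c^{b}_{j'}` (cross-multiplied;
here `b+1` counts blocks, so `colWeight S ((b:ℕ)+1)` includes block `b`, and the
condition is trivially true for the first block). -/
def WellConnected (S : Fin k → J → I) : Prop :=
  ∀ (b : Fin k) (j j' : J), S b j = S b j' →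
    colWeight S ((b : ℕ) + 1) j * colWeight S (b : ℕ) j' =
      colWeight S ((b : ℕ) + 1) j' * colWeight S (b : ℕ) j

/-- The set of rows of block `b` connected to the row of `B_b = ∪_{n<b} A^n` supported
on column `j` (a floret of block `b`, represented by the column `j`). -/
def stage (S : Fin k → J → I) (b : Fin k) (j : J) : Finset I :=
  (univ.filter fun j' => colEquiv S (b : ℕ) j j').image (S b)

/-- The pair `(∪_{n<b} A^n, A^b)` satisfies the floret condition: the sets of rows of the
block `b` connected to two rows of `B_b` are equal or disjoint. -/
def FloretCondition (S : Fin k → J → I) (b : Fin k) : Prop :=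
  ∀ j j' : J, stage S b j = stage S b j' ∨ Disjoint (stage S b j) (stage S b j')

/-- The `i`-th row of block `b`, as a real vector. -/
def rowVec (S : Fin k → J → I) (b : Fin k) (i : I) : J → ℝ :=
  fun j => if S b j = i then 1 else 0

/-- `α^b_i · d`, the dot product of the `i`-th row of block `b` with `d`. -/
def rowDot (S : Fin k → J → I) (b : Fin k) (i : I) (d : J → ℝ) : ℝ :=
  ∑ j, (if S b j = i then d j else 0)

/-- The set of rows of the stacked matrix consisting of the first `ℓ` blocks. -/
def prefixRows (S : Fin k → J → I) (ℓ : ℕ) : Set (J → ℝ) :=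
  {v | ∃ (b : Fin k) (i : I), (b : ℕ) < ℓ ∧ v = rowVec S b i}

/-- The row of `D = B_b ∩ A^b` through column `j0` (the indicator vector of the columns
whose floret pair is that of `j0`). -/
def dRow (S : Fin k → J → I) (b : Fin k) (j0 : J) : J → ℝ :=
  fun j => if stage S b j = stage S b j0 then 1 else 0

/-- The generalized running intersection property: for every block `b ≥ 1` (paper:
`ℓ + 1` with `1 ≤ ℓ ≤ k-1`), (1) the stacked matrix of `B_b = ∪_{n<b}A^n` and `A^b` is
well-connected, (2) the pair `(B_b, A^b)` satisfies the floret condition, and (3) every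
row of `B_b ∩ A^b` lies in the real row span of the first `b` blocks. -/
def GRIP (S : Fin k → J → I) : Prop :=
  ∀ b : Fin k, 0 < (b : ℕ) →
    (∀ j j' : J, S b j = S b j' →
      colWeight S ((b : ℕ) + 1) j * colWeight S (b : ℕ) j' =
        colWeight S ((b : ℕ) + 1) j' * colWeight S (b : ℕ) j) ∧
    FloretCondition S b ∧
    (∀ j0 : J, dRow S b j0 ∈ Submodule.span ℝ (prefixRows S (b : ℕ)))

/-- The level-`b` floret `F^b[i]` containing the `i`-th row of block `b`. -/
def floret (S : Fin k → J → I) (b : Fin k) (i : I) : Finset I :=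
  (univ.filter fun j => S b j = i).biUnion fun j => stage S b j

/-- `Σ_{i' ∈ F^b[i]} α^b_{i'} · d`. -/
def floretSum (S : Fin k → J → I) (b : Fin k) (i : I) (d : J → ℝ) : ℝ :=
  ∑ j, (if S b j ∈ floret S b i then d j else 0)

/-- The likelihood `∏_j p_j^{d_j}` of data `d` at the point `p`. -/
noncomputable def likelihood (d p : J → ℝ) : ℝ := ∏ j, p j ^ d j

/-- The log-linear (partition) model determined by a set of rows: probability
vectors with positive entries whose coordinatewise logarithm lies in the row span. -/
def inModel (Rows : Set (J → ℝ)) (p : J → ℝ) : Prop :=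
  (∀ j, 0 < p j) ∧ (∑ j, p j) = 1 ∧
    (fun j => Real.log (p j)) ∈ Submodule.span ℝ Rows

/-- `p` is a maximum likelihood estimate for the data `d` in the model determined by
`Rows`: it maximizes the likelihood over the closure of the model. -/
def IsMLE (Rows : Set (J → ℝ)) (d p : J → ℝ) : Prop :=
  p ∈ closure {q | inModel Rows q} ∧
    ∀ q ∈ closure {q | inModel Rows q}, likelihood d q ≤ likelihood d p

/-- The iterative proportional scaling iterates: `ips S d 0` is the uniform
distribution, and step `ℓ+1` rescales by the `ℓ`-th block (`q^{ℓ+1}_j =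
q^ℓ_j ⬝ (α^ℓ_{S(ℓ,j)} · d) / (α^ℓ_{S(ℓ,j)} · q^ℓ)`). -/
noncomputable def ips (S : Fin k → J → I) (d : J → ℝ) : ℕ → J → ℝ
  | 0 => fun _ => (Fintype.card J : ℝ)⁻¹
  | ℓ + 1 => fun j =>
      if h : ℓ < k then
        ips S d ℓ j * rowDot S ⟨ℓ, h⟩ (S ⟨ℓ, h⟩ j) d /
          rowDot S ⟨ℓ, h⟩ (S ⟨ℓ, h⟩ j) (ips S d ℓ)
      else ips S d ℓ j

end PM

namespace PM

section Helpers

variable {k m : ℕ} (S : Fin k → Fin m → ℕ)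

theorem ce_refl (l : ℕ) (j : Fin m) : colEquiv S l j j := fun _ _ => rfl

theorem ce_symm {l : ℕ} {j j' : Fin m} (h : colEquiv S l j j') : colEquiv S l j' j :=
  fun b hb => (h b hb).symm

theorem ce_trans {l : ℕ} {j j' j'' : Fin m} (h : colEquiv S l j j') (h' : colEquiv S l j' j'') :
    colEquiv S l j j'' :=
  fun b hb => (h b hb).trans (h' b hb)

theorem ce_filter {l : ℕ} {j j' : Fin m} (h : colEquiv S l j j') :
    (univ.filter fun x => colEquiv S l j x) = univ.filter fun x => colEquiv S l j' x := by
  ext x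
  simp only [mem_filter, mem_univ, true_and]
  exact ⟨fun h1 => ce_trans S (ce_symm S h) h1, fun h1 => ce_trans S h h1⟩

theorem cw_congr {l : ℕ} {j j' : Fin m} (h : colEquiv S l j j') :
    colWeight S l j = colWeight S l j' := by
  unfold colWeight
  rw [ce_filter S h]

theorem cw_pos (l : ℕ) (j : Fin m) : (0 : ℝ) < colWeight S l j := by
  have : 0 < colWeight S l j := card_pos.mpr ⟨j, by simp [ce_refl]⟩
  exact_mod_cast this

theorem ce_succ (b : Fin k) (j j' : Fin m) :
    colEquiv S ((b : ℕ) + 1) j j' ↔ colEquiv S (b : ℕ) j j' ∧ S b j = S b j' := by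
  constructor
  · intro h
    exact ⟨fun c hc => h c (by omega), h b (by omega)⟩
  · rintro ⟨h, h'⟩ c hc
    by_cases hcb : (c : ℕ) < b
    · exact h c hcb
    · have : c = b := Fin.ext (by omega)
      rw [this]; exact h'

theorem filter_succ (b : Fin k) {j0 j : Fin m} (h : colEquiv S (b : ℕ) j0 j) :
    (univ.filter fun x => colEquiv S (b : ℕ) j0 x ∧ S b x = S b j)
      = univ.filter fun x => colEquiv S ((b : ℕ) + 1) j x := by
  ext x
  simp only [mem_filter, mem_univ, true_and, ce_succ]
  exact ⟨fun h1 => ⟨ce_trans S (ce_symm S h) h1.1, h1.2.symm⟩,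
    fun h1 => ⟨ce_trans S h h1.1, h1.2.symm⟩⟩

theorem stage_congr (b : Fin k) {j j' : Fin m} (h : colEquiv S (b : ℕ) j j') :
    stage S b j = stage S b j' := by
  unfold stage
  rw [ce_filter S h]

theorem mem_stage_self (b : Fin k) (j : Fin m) : S b j ∈ stage S b j :=
  mem_image_of_mem _ (by simp [ce_refl])

theorem mem_stage_iff (b : Fin k) (hF : FloretCondition S b) (j j' : Fin m) :
    S b j ∈ stage S b j' ↔ stage S b j = stage S b j' := by
  constructor
  · intro h
    rcases hF j j' with h1 | h1
    · exact h1
    · exact absurd h (Finset.disjoint_left.mp h1 (mem_stage_self S b j))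
  · intro h
    rw [← h]; exact mem_stage_self S b j

/-- Averaging over classes. -/
theorem sum_avg (l : ℕ) (f : Fin m → ℝ) :
    ∑ j, f j = ∑ j, (∑ j' ∈ univ.filter (fun x => colEquiv S l j x), f j') / colWeight S l j := by
  have h1 : ∀ j : Fin m, (∑ j' ∈ univ.filter (fun x => colEquiv S l j x), f j') / colWeight S l j
      = ∑ j', if colEquiv S l j' j then f j' / colWeight S l j' else 0 := by
    intro j
    rw [sum_div, sum_filter]
    refine sum_congr rfl fun j' _ => ?_
    by_cases h : colEquiv S l j j'
    · rw [if_pos h, if_pos (ce_symm S h), cw_congr S h]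
    · rw [if_neg h, if_neg (fun h' => h (ce_symm S h'))]
  simp_rw [h1]
  rw [sum_comm]
  refine sum_congr rfl fun j _ => ?_
  rw [← sum_filter, sum_const, nsmul_eq_mul]
  have := cw_pos S l j
  unfold colWeight at this ⊢
  field_simp

theorem span_const {l : ℕ} {v : Fin m → ℝ} (hv : v ∈ Submodule.span ℝ (prefixRows S l))
    {j j' : Fin m} (h : colEquiv S l j j') : v j = v j' := by
  induction hv using Submodule.span_induction with
  | mem x hx =>
    obtain ⟨b, i, hb, rfl⟩ := hx
    simp [rowVec, h b hb]
  | zero => rfl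
  | add x y _ _ hx hy => simp [hx, hy]
  | smul a x _ hx => simp [hx]

theorem fun_mem_span {l : ℕ} (b : Fin k) (hb : (b : ℕ) < l) (g : ℕ → ℝ) :
    (fun j => g (S b j)) ∈ Submodule.span ℝ (prefixRows S l) := by
  have : (fun j => g (S b j)) = ∑ i ∈ univ.image (S b), g i • rowVec S b i := by
    ext j
    simp [rowVec, Finset.sum_apply]
  rw [this]
  exact Submodule.sum_mem _ fun i _ =>
    Submodule.smul_mem _ _ (Submodule.subset_span ⟨b, i, hb, rfl⟩)

theorem span_mono_succ (l : ℕ) : Submodule.span ℝ (prefixRows S l) ≤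
    Submodule.span ℝ (prefixRows S (l + 1)) := by
  apply Submodule.span_mono
  rintro v ⟨b, i, hb, rfl⟩
  exact ⟨b, i, by omega, rfl⟩

theorem rowDot_pos (b : Fin k) (j : Fin m) {q : Fin m → ℝ} (hq : ∀ j, 0 < q j) :
    0 < rowDot S b (S b j) q := by
  unfold rowDot
  rw [← sum_filter]
  exact sum_pos (fun i _ => hq i) ⟨j, by simp⟩

/-- One scaling step. -/
noncomputable def stepq (b : Fin k) (d q : Fin m → ℝ) : Fin m → ℝ := fun j =>
  q j * rowDot S b (S b j) d / rowDot S b (S b j) q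

theorem rowDot_stepq (b : Fin k) (d q : Fin m → ℝ) (hq : ∀ j, 0 < q j) (i : ℕ) :
    rowDot S b i (stepq S b d q) = rowDot S b i d := by
  by_cases hi : ∃ j, S b j = i
  · obtain ⟨j, rfl⟩ := hi
    have hp := rowDot_pos S b j hq
    have : rowDot S b (S b j) (stepq S b d q) =
        rowDot S b (S b j) q * (rowDot S b (S b j) d / rowDot S b (S b j) q) := by
      conv_rhs => enter [1]; unfold rowDot
      conv_lhs => unfold rowDot
      rw [sum_mul]
      refine sum_congr rfl fun x _ => ?_
      by_cases h : S b x = S b j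
      · simp only [h, if_true, stepq]; ring
      · simp [h]
    rw [this]; field_simp
  · push Not at hi
    simp [rowDot, hi]

theorem rowDot_formula (b : Fin k)
    (hw : ∀ j j' : Fin m, S b j = S b j' →
      colWeight S ((b : ℕ) + 1) j * colWeight S (b : ℕ) j' =
        colWeight S ((b : ℕ) + 1) j' * colWeight S (b : ℕ) j)
    (hF : FloretCondition S b) (q : Fin m → ℝ)
    (hc : ∀ j j', colEquiv S (b : ℕ) j j' → q j = q j') (j : Fin m) :
    rowDot S b (S b j) q = (colWeight S ((b : ℕ) + 1) j / colWeight S (b : ℕ) j) *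
      ∑ x, (if stage S b x = stage S b j then q x else 0) := by
  unfold rowDot
  rw [sum_avg S b, mul_sum]
  refine sum_congr rfl fun x _ => ?_
  by_cases h : stage S b x = stage S b j
  · rw [if_pos h]
    have hm : S b j ∈ stage S b x := (mem_stage_iff S b hF j x).2 h.symm
    obtain ⟨y, hy, hyj⟩ := mem_image.1 hm
    simp only [mem_filter, mem_univ, true_and] at hy
    have h1 : (∑ j' ∈ univ.filter (fun z => colEquiv S (b : ℕ) x z),
        (if S b j' = S b j then q j' else 0)) = colWeight S ((b : ℕ) + 1) y * q x := by
      rw [← sum_filter, filter_filter, ← hyj, filter_succ S b hy]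
      unfold colWeight
      rw [← nsmul_eq_mul, ← sum_const]
      refine sum_congr rfl fun z hz => ?_
      simp only [mem_filter, mem_univ, true_and, ce_succ] at hz
      exact (hc _ _ (ce_trans S hy hz.1)).symm
    rw [h1, cw_congr S hy]
    have h2 := hw y j hyj
    have h2' : (colWeight S ((b : ℕ) + 1) y : ℝ) * colWeight S (b : ℕ) j =
        colWeight S ((b : ℕ) + 1) j * colWeight S (b : ℕ) y := by exact_mod_cast h2
    have p1 := cw_pos S b y
    have p2 := cw_pos S b j
    field_simp
    linear_combination q x * h2'
  · rw [if_neg h, mul_zero, sum_eq_zero, zero_div]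
    intro z hz
    simp only [mem_filter, mem_univ, true_and] at hz
    rw [if_neg]
    intro h'
    apply h
    have : S b j ∈ stage S b x := mem_image.2 ⟨z, by simpa using hz, h'⟩
    exact ((mem_stage_iff S b hF j x).1 this).symm

theorem class_sum (b : Fin k) (hF : FloretCondition S b) (d : Fin m → ℝ) (j0 : Fin m) :
    ∑ j ∈ univ.filter (fun x => colEquiv S (b : ℕ) j0 x),
      rowDot S b (S b j) d / colWeight S ((b : ℕ) + 1) j =
    ∑ x, (if stage S b x = stage S b j0 then d x else 0) := by
  unfold rowDot
  simp_rw [sum_div]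
  rw [sum_comm]
  refine sum_congr rfl fun x _ => ?_
  by_cases h : stage S b x = stage S b j0
  · rw [if_pos h]
    obtain ⟨y, hy, hyx⟩ := mem_image.1 ((mem_stage_iff S b hF x j0).2 h)
    simp only [mem_filter, mem_univ, true_and] at hy
    have h1 : ∀ j, (if S b x = S b j then d x else 0) / (colWeight S ((b : ℕ) + 1) j : ℝ)
       = if S b j = S b y then d x / (colWeight S ((b : ℕ) + 1) j : ℝ) else 0 := by
      intro j
      by_cases h : S b j = S b y
      · rw [if_pos h, if_pos (by rw [h, hyx])]
      · rw [if_neg h, if_neg (by rw [← hyx]; exact fun h' => h h'.symm), zero_div]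
    simp_rw [h1]
    rw [← sum_filter, filter_filter, filter_succ S b hy]
    rw [sum_congr rfl (g := fun _ => d x / (colWeight S ((b : ℕ) + 1) y : ℝ))]
    · rw [sum_const, nsmul_eq_mul]
      have := cw_pos S ((b : ℕ) + 1) y
      unfold colWeight at this ⊢
      field_simp
    · intro z hz
      simp only [mem_filter, mem_univ, true_and] at hz
      rw [cw_congr S hz]
  · rw [if_neg h]
    refine sum_eq_zero fun z hz => ?_
    rw [if_neg, zero_div]
    intro h'
    apply h
    apply (mem_stage_iff S b hF x j0).1
    exact mem_image.2 ⟨z, hz, h'.symm⟩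

theorem stepq_class (b : Fin k)
    (hw : ∀ j j' : Fin m, S b j = S b j' →
      colWeight S ((b : ℕ) + 1) j * colWeight S (b : ℕ) j' =
        colWeight S ((b : ℕ) + 1) j' * colWeight S (b : ℕ) j)
    (hF : FloretCondition S b) (d q : Fin m → ℝ) (hq : ∀ j, 0 < q j)
    (hc : ∀ j j', colEquiv S (b : ℕ) j j' → q j = q j')
    (hQ : ∀ j0, ∑ x, (if stage S b x = stage S b j0 then q x else 0) =
      ∑ x, (if stage S b x = stage S b j0 then d x else 0)) (j0 : Fin m) :
    ∑ j ∈ univ.filter (fun x => colEquiv S (b : ℕ) j0 x), stepq S b d q j =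
    ∑ j ∈ univ.filter (fun x => colEquiv S (b : ℕ) j0 x), q j := by
  have hQpos : 0 < ∑ x, (if stage S b x = stage S b j0 then q x else 0) := by
    rw [← sum_filter]
    exact sum_pos (fun i _ => hq i) ⟨j0, by simp⟩
  have h1 : ∀ j ∈ univ.filter (fun x => colEquiv S (b : ℕ) j0 x), stepq S b d q j =
      (q j0 * colWeight S (b : ℕ) j0 / ∑ x, (if stage S b x = stage S b j0 then q x else 0)) *
      (rowDot S b (S b j) d / colWeight S ((b : ℕ) + 1) j) := by
    intro j hj
    simp only [mem_filter, mem_univ, true_and] at hj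
    unfold stepq
    rw [rowDot_formula S b hw hF q hc j, ← stage_congr S b hj, ← hc _ _ hj, ← cw_congr S hj]
    have p1 := cw_pos S b j0
    have p2 := cw_pos S ((b : ℕ) + 1) j
    field_simp
  rw [sum_congr rfl h1, ← mul_sum, class_sum S b hF, ← hQ, div_mul_cancel₀ _ hQpos.ne']
  rw [sum_congr rfl (g := fun _ => q j0)]
  · rw [sum_const, nsmul_eq_mul, mul_comm]; rfl
  · intro z hz
    simp only [mem_filter, mem_univ, true_and] at hz
    exact (hc _ _ hz).symm

theorem stepq_span (l : ℕ) (q q' v : Fin m → ℝ)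
    (h : ∀ j0, ∑ j ∈ univ.filter (fun x => colEquiv S l j0 x), q' j =
      ∑ j ∈ univ.filter (fun x => colEquiv S l j0 x), q j)
    (hv : v ∈ Submodule.span ℝ (prefixRows S l)) :
    ∑ j, v j * q' j = ∑ j, v j * q j := by
  rw [sum_avg S l, sum_avg S l (fun j => v j * q j)]
  refine sum_congr rfl fun x _ => ?_
  congr 1
  have : ∀ r : Fin m → ℝ, ∑ j ∈ univ.filter (fun y => colEquiv S l x y), v j * r j =
      v x * ∑ j ∈ univ.filter (fun y => colEquiv S l x y), r j := by
    intro r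
    rw [mul_sum]
    refine sum_congr rfl fun z hz => ?_
    simp only [mem_filter, mem_univ, true_and] at hz
    rw [span_const S hv hz]
  rw [this, this, h]

theorem span_marg {l : ℕ} {d q : Fin m → ℝ}
    (h : ∀ b : Fin k, (b : ℕ) < l → ∀ i, rowDot S b i q = rowDot S b i d) {v : Fin m → ℝ}
    (hv : v ∈ Submodule.span ℝ (prefixRows S l)) : ∑ j, v j * q j = ∑ j, v j * d j := by
  induction hv using Submodule.span_induction with
  | mem x hx =>
    obtain ⟨b, i, hb, rfl⟩ := hx
    simpa [rowVec, rowDot] using h b hb i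
  | zero => simp
  | add x y _ _ hx hy => simp [add_mul, sum_add_distrib, hx, hy]
  | smul a x _ hx => simp [mul_assoc, ← mul_sum, hx]

/-- The invariant of the IPS iterates. -/
def Inv (d : Fin m → ℝ) (l : ℕ) (q : Fin m → ℝ) : Prop :=
  (∀ j, 0 < q j) ∧ (fun j => Real.log (q j)) ∈ Submodule.span ℝ (prefixRows S l) ∧
    ∀ b : Fin k, (b : ℕ) < l → ∀ i, rowDot S b i q = rowDot S b i d

theorem stepq_pos (b : Fin k) {d q : Fin m → ℝ} (hd : ∀ j, 0 < d j) (hq : ∀ j, 0 < q j)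
    (j : Fin m) : 0 < stepq S b d q j :=
  div_pos (mul_pos (hq j) (rowDot_pos S b j hd)) (rowDot_pos S b j hq)

theorem stepq_log (b : Fin k) {d q : Fin m → ℝ} (hd : ∀ j, 0 < d j) (hq : ∀ j, 0 < q j)
    (hl : (fun j => Real.log (q j)) ∈ Submodule.span ℝ (prefixRows S ((b : ℕ) + 1))) :
    (fun j => Real.log (stepq S b d q j)) ∈ Submodule.span ℝ (prefixRows S ((b : ℕ) + 1)) := by
  have h2 := fun_mem_span S b (Nat.lt_succ_self (b : ℕ))
    (fun i => Real.log (rowDot S b i d / rowDot S b i q))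
  have h3 := Submodule.add_mem _ hl h2
  convert h3 using 1
  ext j
  have p1 := rowDot_pos S b j hd
  have p2 := rowDot_pos S b j hq
  simp only [Pi.add_apply, stepq]
  rw [mul_div_assoc, Real.log_mul (hq j).ne' (div_pos p1 p2).ne']

theorem inv_step (hgrip : GRIP S) (b : Fin k) (hb : 0 < (b : ℕ)) {d q : Fin m → ℝ}
    (hd : ∀ j, 0 < d j) (hI : Inv S d b q) : Inv S d ((b : ℕ) + 1) (stepq S b d q) := by
  obtain ⟨hq, hl, hm⟩ := hI
  obtain ⟨hw, hF, hD⟩ := hgrip b hb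
  refine ⟨stepq_pos S b hd hq, stepq_log S b hd hq (span_mono_succ S _ hl), ?_⟩
  intro c hc i
  by_cases hcb : (c : ℕ) < b
  · rw [← hm c hcb i]
    have hcq : ∀ j j', colEquiv S (b : ℕ) j j' → q j = q j' := by
      intro j j' h
      have := span_const S hl h
      exact Real.log_injOn_pos (hq j) (hq j') this
    have hQ : ∀ j0, ∑ x, (if stage S b x = stage S b j0 then q x else 0) =
        ∑ x, (if stage S b x = stage S b j0 then d x else 0) := by
      intro j0
      simpa [dRow] using span_marg S hm (hD j0)
    have := stepq_span S b q (stepq S b d q) (rowVec S c i)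
      (stepq_class S b hw hF d q hq hcq hQ) (Submodule.subset_span ⟨c, i, hcb, rfl⟩)
    simpa [rowVec, rowDot] using this
  · have : c = b := Fin.ext (by omega)
    subst this
    exact rowDot_stepq S c d q hq i

theorem ips_succ (d : Fin m → ℝ) (b : Fin k) :
    ips S d ((b : ℕ) + 1) = stepq S b d (ips S d b) := by
  ext j
  simp [ips, stepq]

theorem inv_ips (hgrip : GRIP S) {d : Fin m → ℝ} (hd : ∀ j, 0 < d j) (hm : 0 < m) (l : ℕ)
    (h1 : 1 ≤ l) (hlk : l ≤ k) : Inv S d l (ips S d l) := by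
  induction l, h1 using Nat.le_induction with
  | base =>
    have hq : ∀ j, 0 < ips S d 0 j := by
      intro j; simp [ips, hm]
    have e := ips_succ S d ⟨0, hlk⟩
    simp only [zero_add] at e
    rw [e]
    refine ⟨stepq_pos S _ hd hq, ?_, ?_⟩
    · have := stepq_log S ⟨0, hlk⟩ hd hq ?_
      · simpa using this
      · exact fun_mem_span S ⟨0, hlk⟩ (by simp) (fun _ => Real.log ((Fintype.card (Fin m) : ℝ)⁻¹))
    · intro c hc i
      have : c = ⟨0, hlk⟩ := Fin.ext (by simp; omega)
      subst this
      exact rowDot_stepq S _ d _ hq i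
  | succ l hl ih =>
    have e := ips_succ S d ⟨l, hlk⟩
    simp only at e
    rw [e]
    exact inv_step S hgrip ⟨l, hlk⟩ hl hd (ih (by omega))

theorem inv_mle {d : Fin m → ℝ} (hd : ∀ j, 0 < d j) (hd1 : (∑ j, d j) = 1) (l : ℕ)
    (h1 : 1 ≤ l) (hlk : l ≤ k) {q : Fin m → ℝ} (hI : Inv S d l q) :
    IsMLE (prefixRows S l) d q := by
  obtain ⟨hq, hl, hm⟩ := hI
  have hone : (fun _ : Fin m => (1 : ℝ)) ∈ Submodule.span ℝ (prefixRows S l) :=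
    fun_mem_span S ⟨0, by omega⟩ (Nat.lt_of_lt_of_le Nat.zero_lt_one h1) (fun _ => 1)
  have hq1 : ∑ j, q j = 1 := by
    have := span_marg S hm hone
    simpa [hd1] using this
  refine ⟨subset_closure ⟨hq, hq1, hl⟩, ?_⟩
  have hcont : Continuous (fun p : Fin m → ℝ => likelihood d p) := by
    unfold likelihood
    refine continuous_finsetProd _ fun j _ => ?_
    exact (Real.continuous_rpow_const (hd j).le).comp (continuous_apply j)
  have hclosed : IsClosed {p : Fin m → ℝ | likelihood d p ≤ likelihood d q} :=
    isClosed_le hcont continuous_const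
  refine fun p hp => closure_minimal ?_ hclosed hp
  rintro p ⟨hp, hp1, hpl⟩
  have key : ∀ r : Fin m → ℝ, (∀ j, 0 < r j) →
      likelihood d r = Real.exp (∑ j, Real.log (r j) * d j) := by
    intro r hr
    rw [Real.exp_sum]
    exact prod_congr rfl fun j _ => Real.rpow_def_of_pos (hr j) _
  show likelihood d p ≤ likelihood d q
  rw [key p hp, key q hq, Real.exp_le_exp, ← span_marg S hm hpl, ← span_marg S hm hl,
    ← sub_nonpos, ← sum_sub_distrib]
  calc ∑ j, (Real.log (p j) * q j - Real.log (q j) * q j) ≤ ∑ j, (p j - q j) := by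
        refine sum_le_sum fun j _ => ?_
        have h := Real.log_le_sub_one_of_pos (div_pos (hp j) (hq j))
        rw [Real.log_div (hp j).ne' (hq j).ne'] at h
        have h2 := mul_le_mul_of_nonneg_right h (hq j).le
        have h3 : (p j / q j - 1) * q j = p j - q j := by
          have := (hq j).ne'
          field_simp
        linarith
    _ = 0 := by rw [sum_sub_distrib, hp1, hq1, sub_self]

end Helpers

end PM

open Finset PM in
/-- Let `A` (encoded by `S`) be a multipartition matrix with `k`
blocks and `m` columns satisfying the GRIP, and let `d` be a normalized data vector with
positive entries.  Then for every `1 ≤ ℓ ≤ k`, the `ℓ`-th IPS iterate (started from the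
uniform distribution) is the maximum likelihood estimate of `d` in the partition model
`M(A^{1,…,ℓ})` of the submatrix consisting of the first `ℓ` blocks. -/
theorem ips_step_is_prefix_mle {k m : ℕ} (S : Fin k → Fin m → ℕ) (hgrip : GRIP S)
    (d : Fin m → ℝ) (hd : ∀ j, 0 < d j) (hd1 : (∑ j, d j) = 1) :
    ∀ ℓ : ℕ, 1 ≤ ℓ → ℓ ≤ k → IsMLE (prefixRows S ℓ) d (ips S d ℓ) := by
  intro ℓ h1 hk
  have hm : 0 < m := by
    rcases Nat.eq_zero_or_pos m with h | h
    · subst h; simp at hd1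
    · exact h
  exact inv_mle S hd hd1 ℓ h1 hk (inv_ips S hgrip hd hm ℓ h1 hk)
end

section
/- Let Γ be a simplicial complex on {1,…,p} with facets F_1,…,F_k, let A = A_Γ be the binary hierarchical multipartition matrix, fix 1 ≤ ℓ ≤ k − 1, set Q = F_1 ∪ ⋯ ∪ F_ℓ, and suppose there exists s ≤ ℓ with Q ∩ F_{ℓ+1} = F_s ∩ F_{ℓ+1}. Let B = ∪_{n=1}^ℓ A^n and D = B ∩ A^{ℓ+1}, whose rows are indexed by subsets T ⊆ Q ∩ F_{ℓ+1}. Then for each T ⊆ Q ∩ F_{ℓ+1}, the row α^D_T of D equals Σ_{U ⊆ F_s : U ∩ F_{ℓ+1} = T} α^s_U, a sum of rows of the block A^s. In particular, every row of D lies in the real row span of A^{1,…,ℓ}. -/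
open Finset

open Finset

/-- The binary hierarchical multipartition matrix `A_Γ` of a list of facets
`F : Fin k → Finset (Fin p)`: columns are indexed by subsets `T ⊆ {1,…,p}`, and the row
of block `b` supported on column `T` is the subset `T ∩ F b ⊆ F b` (rows of block `b`
are indexed by subsets of `{1,…,p}`; subsets not contained in `F b` index zero rows). -/
def hierS {p k : ℕ} (F : Fin k → Finset (Fin p)) :
    Fin k → Finset (Fin p) → Finset (Fin p) :=
  fun b T => T ∩ F b

theorem hier_colEquiv_iff {p k : ℕ} (F : Fin k → Finset (Fin p)) (b : Fin k)
    (Q : Finset (Fin p))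
    (hQ : Q = (univ.filter fun b' : Fin k => (b' : ℕ) < (b : ℕ)).biUnion F)
    (j j' : Finset (Fin p)) :
    PM.colEquiv (hierS F) (b : ℕ) j j' ↔ ∀ x ∈ Q, (x ∈ j ↔ x ∈ j') := by
  subst hQ
  simp only [PM.colEquiv, hierS, Finset.ext_iff, mem_inter, mem_biUnion, mem_filter, mem_univ,
    true_and]
  constructor
  · rintro h x ⟨c, hc, hx⟩
    have := h c hc x
    tauto
  · intro h c hc x
    have := h x
    constructor
    · rintro ⟨h1, h2⟩
      exact ⟨(this ⟨c, hc, h2⟩).1 h1, h2⟩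
    · rintro ⟨h1, h2⟩
      exact ⟨(this ⟨c, hc, h2⟩).2 h1, h2⟩

theorem hier_stage_eq_iff {p k : ℕ} (F : Fin k → Finset (Fin p)) (b : Fin k)
    (Q : Finset (Fin p))
    (hQ : Q = (univ.filter fun b' : Fin k => (b' : ℕ) < (b : ℕ)).biUnion F)
    (j j0 : Finset (Fin p)) :
    PM.stage (hierS F) b j = PM.stage (hierS F) b j0 ↔ j ∩ Q ∩ F b = j0 ∩ Q ∩ F b := by
  have key : ∀ (i V : Finset (Fin p)), V ∈ PM.stage (hierS F) b i ↔
      V ⊆ F b ∧ V ∩ Q = i ∩ Q ∩ F b := by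
    intro i V
    simp only [PM.stage, mem_image, mem_filter, mem_univ, true_and,
      hier_colEquiv_iff F b Q hQ]
    constructor
    · rintro ⟨W, hW, rfl⟩
      refine ⟨inter_subset_right, ?_⟩
      ext x
      have := hW x
      simp only [hierS, mem_inter]
      tauto
    · rintro ⟨h1, h2⟩
      refine ⟨V ∪ ((i ∩ Q) \ F b), ?_, ?_⟩
      · intro x hx
        have h3 := Finset.ext_iff.1 h2 x
        have h4 := @h1 x
        simp only [mem_inter, mem_union, mem_sdiff] at *
        tauto
      · ext x
        have h4 := @h1 x
        simp only [hierS, mem_inter, mem_union, mem_sdiff] at *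
        tauto
  constructor
  · intro h
    have h1 : j ∩ F b ∈ PM.stage (hierS F) b j :=
      (key _ _).2 ⟨inter_subset_right, inter_right_comm _ _ _⟩
    rw [h] at h1
    rw [← ((key _ _).1 h1).2, inter_right_comm]
  · intro h
    ext V
    rw [key, key, h]

open Finset PM in
/-- part of the proof of Proposition 4.1.  Let `A = A_Γ` be the
binary hierarchical multipartition matrix of facets `F_1,…,F_k`, fix a block `b` with
`0 < b`, set `Q = F_1 ∪ ⋯ ∪ F_b` (union over the preceding blocks), and suppose there
is `s < b` with `Q ∩ F b = F s ∩ F b` (running intersection).  Let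
`D = (∪_{n<b} A^n) ∩ A^b`, whose rows are indexed by subsets `T ⊆ Q ∩ F b`; the row of
`D` through a column `j0` corresponds to `T = j0 ∩ Q ∩ F b`.  Then this row of `D`
equals `Σ_{U ⊆ F_s, U ∩ F b = T} α^s_U`, a sum of rows of the block `A^s`.  In
particular, every row of `D` lies in the real row span of `A^{1,…,ℓ}` (the first `b`
blocks). -/
theorem hier_dRow_eq_sum {p k : ℕ} (F : Fin k → Finset (Fin p)) (b : Fin k)
    (hb : 0 < (b : ℕ)) (Q : Finset (Fin p))
    (hQ : Q = (univ.filter fun b' : Fin k => (b' : ℕ) < (b : ℕ)).biUnion F)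
    (s : Fin k) (hs : (s : ℕ) < (b : ℕ)) (hrip : Q ∩ F b = F s ∩ F b) :
    ∀ j0 : Finset (Fin p),
      (dRow (hierS F) b j0 = fun Scol =>
        ∑ U ∈ (F s).powerset.filter (fun U => U ∩ F b = j0 ∩ Q ∩ F b),
          rowVec (hierS F) s U Scol) ∧
      dRow (hierS F) b j0 ∈ Submodule.span ℝ (prefixRows (hierS F) (b : ℕ)) := by
  intro j0
  have hmain : dRow (hierS F) b j0 = fun Scol =>
        ∑ U ∈ (F s).powerset.filter (fun U => U ∩ F b = j0 ∩ Q ∩ F b),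
          rowVec (hierS F) s U Scol := by
    funext j
    simp only [dRow, rowVec, hier_stage_eq_iff F b Q hQ, Finset.sum_ite_eq]
    refine if_congr ?_ rfl rfl
    have e : j ∩ Q ∩ F b = j ∩ F s ∩ F b := by
      rw [inter_assoc, hrip, inter_assoc]
    rw [mem_filter, mem_powerset, e]
    exact ⟨fun h => ⟨inter_subset_right, h⟩, fun h => h.2⟩
  refine ⟨hmain, ?_⟩
  have h2 : dRow (hierS F) b j0 =
      ∑ U ∈ (F s).powerset.filter (fun U => U ∩ F b = j0 ∩ Q ∩ F b),
          rowVec (hierS F) s U := by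
    rw [hmain]
    funext j
    rw [Finset.sum_apply]
  rw [h2]
  exact Submodule.sum_mem _ fun U _ => Submodule.subset_span ⟨s, U, hs, rfl⟩
end
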